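/- arXiv:1803.05060 — 14 statements merged into one kernel-verified Lean document; each statement's English description precedes it below -/
import Mathlib

section
/- Let A be an abelian category, let i : F ⟶ M be a fully invariant monomorphism, and suppose M = M₁ ⊕ M₂ is a biproduct decomposition with injections u₁ : M₁ ⟶ M and u₂ : M₂ ⟶ M. For l = 1,2 let F ∩ M_l denote the pullback of i and u_l, with projections k_l : F ∩ M_l ⟶ F. Then the induced morphism [k₁, k₂] : (F ∩ M₁) ⊕ (F ∩ M₂) ⟶ F out of the biproduct is an isomorphism; in particular F ≅ (F ∩ M₁) ⊕ (F ∩ M₂). -/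
open CategoryTheory CategoryTheory.Limits

universe v u

/-- A monomorphism `i : F ⟶ M` is *fully invariant* if for each endomorphism
`h : M ⟶ M` there is `α : F ⟶ F` with `h ∘ i = i ∘ α`. -/
def FullyInvariant {A : Type u} [Category.{v} A] {F M : A} (i : F ⟶ M) : Prop :=
  ∀ h : M ⟶ M, ∃ α : F ⟶ F, i ≫ h = α ≫ i

/-- If `i : F ⟶ M₁ ⊞ M₂` is a fully invariant monomorphism, then the
induced morphism `(F ∩ M₁) ⊞ (F ∩ M₂) ⟶ F` is an isomorphism;
here `F ∩ Mₗ` is the pullback of `i` and the biproduct injection. -/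
theorem stmt_0 {A : Type u} [Category.{v} A] [Abelian A] {F M₁ M₂ : A}
    (i : F ⟶ M₁ ⊞ M₂) [Mono i] (hi : FullyInvariant i) :
    IsIso (biprod.desc (pullback.fst i biprod.inl) (pullback.fst i biprod.inr)) := by
  obtain ⟨α₁, h₁⟩ := hi (biprod.fst ≫ biprod.inl)
  obtain ⟨α₂, h₂⟩ := hi (biprod.snd ≫ biprod.inr)
  obtain ⟨s₁, hf₁, hs₁⟩ := pullback.exists_lift (f := i) (g := biprod.inl) α₁ (i ≫ biprod.fst)
    (by rw [← h₁, Category.assoc])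
  obtain ⟨s₂, hf₂, hs₂⟩ := pullback.exists_lift (f := i) (g := biprod.inr) α₂ (i ≫ biprod.snd)
    (by rw [← h₂, Category.assoc])
  refine ⟨biprod.lift s₁ s₂, ?_, ?_⟩
  · ext : 2 <;> rw [← cancel_mono (pullback.snd i _)] <;>
      simp [hs₁, hs₂, pullback.condition_assoc]
  · rw [← cancel_mono i, biprod.lift_desc, hf₁, hf₂, Preadditive.add_comp, ← h₁, ← h₂,
      ← Preadditive.comp_add, biprod.total, Category.comp_id, Category.id_comp]
end

section
/- Let A be an abelian category, let i : F ⟶ M be a fully invariant monomorphism, and let j : G ⟶ M be a monomorphism. Assume every morphism h : G ⟶ G extends to M, i.e., for every h : G ⟶ G there exists f : M ⟶ M with f ∘ j = j ∘ h. Let F ∩ G denote the pullback of i and j, with projection u : F ∩ G ⟶ G. Then u is a fully invariant monomorphism, i.e., for every morphism h : G ⟶ G there exists γ : F ∩ G ⟶ F ∩ G with h ∘ u = u ∘ γ. -/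
open CategoryTheory CategoryTheory.Limits

universe v u

/-- If `i : F ⟶ M` is a fully invariant monomorphism, `j : G ⟶ M` is a
monomorphism, and every endomorphism of `G` extends to `M`, then the pullback
projection `u : F ∩ G ⟶ G` is a fully invariant monomorphism. -/
theorem stmt_2 {A : Type u} [Category.{v} A] [Abelian A] {F G M : A}
    (i : F ⟶ M) (j : G ⟶ M) [Mono i] [Mono j]
    (hi : FullyInvariant i)
    (hext : ∀ h : G ⟶ G, ∃ f : M ⟶ M, j ≫ f = h ≫ j) :
    Mono (pullback.snd i j) ∧ FullyInvariant (pullback.snd i j) := by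
  refine ⟨inferInstance, fun h => ?_⟩
  obtain ⟨f, hf⟩ := hext h
  obtain ⟨α, hα⟩ := hi f
  refine ⟨pullback.lift (pullback.fst i j ≫ α) (pullback.snd i j ≫ h) ?_,
    (pullback.lift_snd _ _ _).symm⟩
  rw [Category.assoc, ← hα, Category.assoc, ← hf, pullback.condition_assoc]
end

section
/- Let A be an abelian category, let g : B ⟶ B' be an epimorphism and let d' : B' ⟶ C be a morphism such that the composite d = d' ∘ g : B ⟶ C is a fully coinvariant split epimorphism. Then d' is a fully coinvariant split epimorphism. -/
open CategoryTheory CategoryTheory.Limits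

universe v u

/-- An epimorphism `d : M ⟶ C` is *fully coinvariant* if for each endomorphism
`h : M ⟶ M` there is `γ : C ⟶ C` with `d ∘ h = γ ∘ d`. -/
def FullyCoinvariant {A : Type u} [Category.{v} A] {M C : A} (d : M ⟶ C) : Prop :=
  ∀ h : M ⟶ M, ∃ γ : C ⟶ C, h ≫ d = d ≫ γ

/-- If `g : B ⟶ B'` is an epimorphism, `d' : B' ⟶ C` is a morphism, and
`d = d' ∘ g` is a fully coinvariant split epimorphism, then `d'` is a fully
coinvariant split epimorphism. -/
theorem stmt_4 {A : Type u} [Category.{v} A] [Abelian A] {B B' C : A}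
    (g : B ⟶ B') [Epi g] (d' : B' ⟶ C)
    (h₁ : FullyCoinvariant (g ≫ d')) (h₂ : IsSplitEpi (g ≫ d')) :
    FullyCoinvariant d' ∧ IsSplitEpi d' := by
  obtain ⟨⟨s, hs⟩⟩ := h₂.exists_splitEpi
  refine ⟨fun h ↦ ?_, IsSplitEpi.mk' ⟨s ≫ g, by simpa using hs⟩⟩
  obtain ⟨γ, hγ⟩ := h₁ (g ≫ h ≫ d' ≫ s)
  refine ⟨γ, ?_⟩
  rw [← cancel_epi g]
  simpa [hs] using hγ
end

section
/- Let A be an abelian category and let i : A ⟶ B and i' : A' ⟶ B' be morphisms such that the induced morphism i ⊕ i' : A ⊕ A' ⟶ B ⊕ B' of biproducts (with matrix diag(i, i')) is a fully invariant monomorphism. Then both i : A ⟶ B and i' : A' ⟶ B' are fully invariant monomorphisms. -/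
open CategoryTheory CategoryTheory.Limits

universe v u

/-- Full invariance is inherited by retracts in the category of arrows. -/
theorem FullyInvariant.of_retractArrow {C : Type u} [Category.{v} C] {X Y Z W : C}
    {f : X ⟶ Y} {g : Z ⟶ W} (r : RetractArrow f g) (hg : FullyInvariant g) :
    FullyInvariant f := by
  intro h
  obtain ⟨α, hα⟩ := hg (r.r.right ≫ h ≫ r.i.right)
  refine ⟨r.i.left ≫ α ≫ r.r.left, ?_⟩
  calc
    f ≫ h = r.i.left ≫ (g ≫ r.r.right ≫ h ≫ r.i.right) ≫ r.r.right := by simp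
    _ = (r.i.left ≫ α ≫ r.r.left) ≫ f := by simp [hα]

/-- The first summand of a biproduct of morphisms is a retract of it. -/
noncomputable def biprodMapRetractArrowLeft {C : Type u} [Category.{v} C] [HasZeroMorphisms C]
    [HasBinaryBiproducts C] {X Y X' Y' : C} (f : X ⟶ Y) (f' : X' ⟶ Y') :
    RetractArrow f (biprod.map f f') where
  i := Arrow.homMk biprod.inl biprod.inl
  r := Arrow.homMk biprod.fst biprod.fst

/-- The second summand of a biproduct of morphisms is a retract of it. -/
noncomputable def biprodMapRetractArrowRight {C : Type u} [Category.{v} C] [HasZeroMorphisms C]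
    [HasBinaryBiproducts C] {X Y X' Y' : C} (f : X ⟶ Y) (f' : X' ⟶ Y') :
    RetractArrow f' (biprod.map f f') where
  i := Arrow.homMk biprod.inr biprod.inr
  r := Arrow.homMk biprod.snd biprod.snd

/-- If the diagonal morphism `i ⊕ i' : A ⊕ A' ⟶ B ⊕ B'` of biproducts is a
fully invariant monomorphism, then both `i` and `i'` are fully invariant
monomorphisms. -/
theorem stmt_5 {𝒜 : Type u} [Category.{v} 𝒜] [Abelian 𝒜] {A A' B B' : 𝒜}
    (i : A ⟶ B) (i' : A' ⟶ B')
    (hmono : Mono (biprod.map i i')) (hfi : FullyInvariant (biprod.map i i')) :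
    (Mono i ∧ FullyInvariant i) ∧ (Mono i' ∧ FullyInvariant i') := by
  have mono_of_retract {X Y : 𝒜} {f : X ⟶ Y} (r : RetractArrow f (biprod.map i i')) : Mono f :=
    MorphismProperty.of_retract (P := .monomorphisms 𝒜) r hmono
  exact ⟨⟨mono_of_retract (biprodMapRetractArrowLeft i i'),
      hfi.of_retractArrow (biprodMapRetractArrowLeft i i')⟩,
    ⟨mono_of_retract (biprodMapRetractArrowRight i i'),
      hfi.of_retractArrow (biprodMapRetractArrowRight i i')⟩⟩
end

section
/- Let A be an abelian category and let 0 ⟶ F →i M →d C ⟶ 0 be a fully invariant short exact sequence in A. Then the following are equivalent: (i) M is strongly self-F-split; (ii) M is self-F-split and every direct summand of M containing F is fully invariant, i.e., for every split monomorphism s : X ⟶ M through which i factors, s is a fully invariant monomorphism. -/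
open CategoryTheory CategoryTheory.Limits

universe v u

/-- Given a fully invariant short exact sequence `0 ⟶ F ⟶ M ⟶ C ⟶ 0`,
the object `M` is strongly self-`F`-split (for every `g : M ⟶ M` the kernel of
`d ∘ g` is a fully invariant split monomorphism) iff `M` is self-`F`-split
(the kernels are split monomorphisms) and every direct summand of `M`
containing `F` is fully invariant. -/
theorem stmt_7 {A : Type u} [Category.{v} A] [Abelian A] {F M C : A}
    (i : F ⟶ M) (d : M ⟶ C) (w : i ≫ d = 0)
    (hse : (ShortComplex.mk i d w).ShortExact) (hi : FullyInvariant i) :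
    (∀ g : M ⟶ M, IsSplitMono (kernel.ι (g ≫ d)) ∧ FullyInvariant (kernel.ι (g ≫ d))) ↔
      ((∀ g : M ⟶ M, IsSplitMono (kernel.ι (g ≫ d))) ∧
        ∀ (X : A) (s : X ⟶ M), IsSplitMono s → (∃ t : F ⟶ X, t ≫ s = i) →
          FullyInvariant s) := by
  constructor
  · refine fun H => ⟨fun g => (H g).1, ?_⟩
    rintro X s hs ⟨t, ht⟩ h
    have hr : s ≫ retraction s = 𝟙 X := IsSplitMono.id s
    set r := retraction s
    -- `X` is the kernel of `e ≫ d` for the complementary idempotent `e = 𝟙 M - r ≫ s`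
    have hse' : s ≫ (𝟙 M - r ≫ s) = 0 := by
      rw [Preadditive.comp_sub, reassoc_of% hr, Category.comp_id, sub_self]
    have he : (𝟙 M - r ≫ s) ≫ (𝟙 M - r ≫ s) = 𝟙 M - r ≫ s := by
      rw [Preadditive.sub_comp, Category.assoc, hse', comp_zero, sub_zero, Category.id_comp]
    have hsub : ∀ {K : A} (k : K ⟶ M), k ≫ (𝟙 M - r ≫ s) = k - k ≫ r ≫ s := fun k => by
      rw [Preadditive.comp_sub, Category.comp_id]
    set e := 𝟙 M - r ≫ s
    obtain ⟨α, hα⟩ := (H e).2 h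
    have hl : kernel.lift (e ≫ d) s (by rw [reassoc_of% hse', zero_comp]) ≫
        kernel.ι (e ≫ d) = s := kernel.lift_ι _ _ _
    set l := kernel.lift (e ≫ d) s (by rw [reassoc_of% hse', zero_comp])
    have := hse.mono_f
    obtain ⟨t', ht'⟩ : ∃ t' : kernel (e ≫ d) ⟶ F, t' ≫ i = kernel.ι (e ≫ d) ≫ e :=
      ⟨hse.exact.lift (kernel.ι (e ≫ d) ≫ e)
        (by rw [Category.assoc]; exact kernel.condition _), hse.exact.lift_f _ _⟩
    have hιe : kernel.ι (e ≫ d) ≫ e = 0 := by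
      calc kernel.ι (e ≫ d) ≫ e = (kernel.ι (e ≫ d) ≫ e) ≫ e := by rw [Category.assoc, he]
        _ = 0 := by
          rw [← ht', ← ht, Category.assoc, Category.assoc, hse', comp_zero, comp_zero]
    have hι : kernel.ι (e ≫ d) ≫ r ≫ s = kernel.ι (e ≫ d) :=
      (sub_eq_zero.mp ((hsub _).symm.trans hιe)).symm
    refine ⟨l ≫ α ≫ kernel.ι (e ≫ d) ≫ r, ?_⟩
    simp only [Category.assoc]
    rw [hι, ← hα, reassoc_of% hl]
  · rintro ⟨H, H'⟩ g
    obtain ⟨α, hα⟩ := hi g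
    exact ⟨H g, H' _ _ (H g)
      ⟨kernel.lift _ i (by rw [reassoc_of% hα, w, comp_zero]), kernel.lift_ι _ _ _⟩⟩
end

section
/- Let A be an abelian category, let 0 ⟶ F →i M →d C ⟶ 0 be a fully invariant short exact sequence, and assume M is self-F-split. Let n : N ⟶ M be a split monomorphism through which i factors (a direct summand of M containing F), and let k : K ⟶ M be a split monomorphism (a direct summand of M). Then the intersection K ∩ N (the pullback of k and n), regarded as a subobject of M, is a direct summand of M, i.e., its inclusion into M is a split monomorphism. -/
open CategoryTheory CategoryTheory.Limits

universe v u

/-- Let `0 ⟶ F ⟶ M ⟶ C ⟶ 0` be a fully invariant short exact sequence with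
`M` self-`F`-split. If `n : N ⟶ M` is a direct summand containing `F` and
`k : K ⟶ M` is a direct summand, then the intersection `K ∩ N` (the pullback
of `k` and `n`), viewed inside `M`, is a direct summand of `M`. -/
theorem stmt_8 {A : Type u} [Category.{v} A] [Abelian A] {F M C : A}
    (i : F ⟶ M) (d : M ⟶ C) (w : i ≫ d = 0)
    (hse : (ShortComplex.mk i d w).ShortExact) (hi : FullyInvariant i)
    (hsplit : ∀ g : M ⟶ M, IsSplitMono (kernel.ι (g ≫ d)))
    {N K : A} (n : N ⟶ M) [IsSplitMono n] (t : F ⟶ N) (ht : t ≫ n = i)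
    (k : K ⟶ M) [IsSplitMono k] :
    IsSplitMono (pullback.fst k n ≫ k) := by
  obtain ⟨q, hq⟩ : ∃ q : M ⟶ M, q = 𝟙 M - retraction n ≫ n := ⟨_, rfl⟩
  obtain ⟨g, hg⟩ : ∃ g : M ⟶ M, g = retraction k ≫ k ≫ q := ⟨_, rfl⟩
  have hnq : n ≫ q = 0 := by simp [hq, Preadditive.comp_sub]
  have hqn : q ≫ retraction n ≫ n = 0 := by simp [hq, Preadditive.sub_comp]
  have hin : i ≫ retraction n ≫ n = i := by simp [← ht]
  have := hse.mono_f
  have hker : kernel.ι (g ≫ d) ≫ g = 0 := by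
    have hd : (kernel.ι (g ≫ d) ≫ g) ≫ d = 0 := by simp [kernel.condition]
    obtain ⟨y, hy⟩ : ∃ y : kernel (g ≫ d) ⟶ F, y ≫ i = kernel.ι (g ≫ d) ≫ g :=
      ⟨hse.exact.lift _ hd, hse.exact.lift_f _ hd⟩
    calc kernel.ι (g ≫ d) ≫ g = y ≫ i := hy.symm
      _ = (y ≫ i) ≫ retraction n ≫ n := by rw [Category.assoc, hin]
      _ = 0 := by rw [hy]; simp only [hg, Category.assoc, hqn, comp_zero]
  have hlift : (kernel.ι (g ≫ d) ≫ retraction k) ≫ k =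
      (kernel.ι (g ≫ d) ≫ retraction k ≫ k ≫ retraction n) ≫ n := by
    rw [← sub_eq_zero, ← hker]
    simp [hg, hq, Preadditive.comp_sub]
  have hj : (pullback.fst k n ≫ k) ≫ g ≫ d = 0 := by
    have hfst : (pullback.fst k n ≫ k) ≫ g = 0 := by
      calc (pullback.fst k n ≫ k) ≫ g = (pullback.fst k n ≫ k) ≫ q := by simp [hg]
        _ = 0 := by rw [pullback.condition, Category.assoc, hnq, comp_zero]
    rw [← Category.assoc, hfst, zero_comp]
  have := hsplit g
  have hret : (pullback.fst k n ≫ k) ≫ retraction (kernel.ι (g ≫ d)) =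
      kernel.lift (g ≫ d) _ hj := by
    conv_lhs => rw [← kernel.lift_ι (g ≫ d) _ hj]
    rw [Category.assoc, IsSplitMono.id, Category.comp_id]
  refine ⟨⟨⟨retraction (kernel.ι (g ≫ d)) ≫ pullback.lift _ _ hlift, ?_⟩⟩⟩
  rw [← Category.assoc, hret]
  apply pullback.hom_ext
  · rw [Category.assoc, pullback.lift_fst, kernel.lift_ι_assoc]
    simp
  · rw [Category.assoc, pullback.lift_snd, kernel.lift_ι_assoc]
    simp [pullback.condition_assoc]
end

section
/- Let A be an abelian category, let 0 ⟶ F →i M →d C ⟶ 0 be a fully invariant short exact sequence, and assume M is self-F-split. Then for every split monomorphism k : K ⟶ M (i.e., for every direct summand K of M), the intersection F ∩ K (the pullback of i and k), regarded as a subobject of M, is a direct summand of M, i.e., its inclusion into M is a split monomorphism. -/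
open CategoryTheory CategoryTheory.Limits

universe v u

/-- Let `0 ⟶ F ⟶ M ⟶ C ⟶ 0` be a fully invariant short exact sequence with
`M` self-`F`-split. Then for every direct summand `k : K ⟶ M`, the
intersection `F ∩ K` (the pullback of `i` and `k`), viewed inside `M`, is a
direct summand of `M`. -/
theorem stmt_9 {A : Type u} [Category.{v} A] [Abelian A] {F M C : A}
    (i : F ⟶ M) (d : M ⟶ C) (w : i ≫ d = 0)
    (hse : (ShortComplex.mk i d w).ShortExact) (hi : FullyInvariant i)
    (hsplit : ∀ g : M ⟶ M, IsSplitMono (kernel.ι (g ≫ d)))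
    {K : A} (k : K ⟶ M) [IsSplitMono k] :
    IsSplitMono (pullback.fst i k ≫ i) := by
  have : Mono i := hse.mono_f
  have hd : kernel.ι (𝟙 M ≫ d) ≫ d = 0 := by simpa using kernel.condition (𝟙 M ≫ d)
  obtain ⟨c, hc⟩ : ∃ c : kernel (𝟙 M ≫ d) ⟶ F, c ≫ i = kernel.ι (𝟙 M ≫ d) :=
    ⟨_, (KernelFork.IsLimit.lift' hse.fIsKernel (kernel.ι (𝟙 M ≫ d)) hd).2⟩
  have := hsplit (𝟙 M)
  obtain ⟨r, hr⟩ : ∃ r : M ⟶ F, i ≫ r = 𝟙 F := by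
    obtain ⟨l, hl⟩ : ∃ l : F ⟶ kernel (𝟙 M ≫ d), l ≫ kernel.ι (𝟙 M ≫ d) = i :=
      ⟨kernel.lift _ i (by simpa using w), kernel.lift_ι _ _ _⟩
    refine ⟨retraction (kernel.ι (𝟙 M ≫ d)) ≫ c, ?_⟩
    rw [← cancel_mono i, Category.assoc, Category.assoc, hc, Category.id_comp i]
    nth_rw 1 [← hl]
    rw [Category.assoc, IsSplitMono.id_assoc, hl]
  obtain ⟨α, hα⟩ := hi (retraction k ≫ k)
  refine ⟨⟨pullback.lift (r ≫ α) (r ≫ i ≫ retraction k) (by simp [← hα]), ?_⟩⟩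
  rw [← cancel_mono (pullback.fst i k), ← cancel_mono i]
  simp only [Category.assoc, pullback.lift_fst, Category.id_comp]
  rw [reassoc_of% hr, ← hα, pullback.condition_assoc, IsSplitMono.id_assoc, pullback.condition]
end

section
/- Let A be an abelian category, let 0 ⟶ F →i N →d C ⟶ 0 be a fully invariant short exact sequence, let e : M ⟶ M' be an epimorphism, and let m : N' ⟶ N be a monomorphism. Let F ∩ N' denote the pullback of i and m, with projection u : F ∩ N' ⟶ N'. Assume that u is a fully invariant monomorphism and that N is M-F-split. Then N' is M'-(F ∩ N')-split, i.e., for every morphism g : M' ⟶ N' the kernel of d' ∘ g is a split monomorphism, where d' : N' ⟶ C' is the cokernel of u. -/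
open CategoryTheory CategoryTheory.Limits

universe v u

/-- If `f` and `f'` are annihilated by the same morphisms and the kernel of `e ≫ f` splits for an
epimorphism `e`, then the kernel of `f'` splits. -/
theorem isSplitMono_kernel_of_epi_comp {A : Type u} [Category.{v} A] [Abelian A]
    {M M' X Y : A} (e : M ⟶ M') [Epi e] (f : M' ⟶ X) (f' : M' ⟶ Y)
    (hf : ∀ {Z : A} (z : Z ⟶ M'), z ≫ f = 0 ↔ z ≫ f' = 0)
    [IsSplitMono (kernel.ι (e ≫ f))] : IsSplitMono (kernel.ι f') := by
  let p : kernel (e ≫ f) ⟶ kernel f' :=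
    kernel.lift f' (kernel.ι (e ≫ f) ≫ e) ((hf _).1 (by simp))
  have hp : p ≫ kernel.ι f' = kernel.ι (e ≫ f) ≫ e := kernel.lift_ι _ _ _
  have key {Z : A} (z : Z ⟶ M) (y : Z ⟶ kernel f') (h : z ≫ e = y ≫ kernel.ι f') :
      z ≫ retraction (kernel.ι (e ≫ f)) ≫ p = y := by
    have hz : z ≫ e ≫ f = 0 := by
      rw [← Category.assoc, hf, h, Category.assoc, kernel.condition, comp_zero]
    rw [← kernel.lift_ι (e ≫ f) z hz, Category.assoc, IsSplitMono.id_assoc,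
      ← cancel_mono (kernel.ι f'), Category.assoc, hp, kernel.lift_ι_assoc, h]
  have h0 : kernel.ι e ≫ retraction (kernel.ι (e ≫ f)) ≫ p = 0 := key _ _ (by simp)
  obtain ⟨r, hr⟩ := Cofork.IsColimit.desc'
    (Abelian.epiIsCokernelOfKernel _ (kernelIsKernel e)) _
    (h0.trans zero_comp.symm)
  replace hr : e ≫ r = retraction (kernel.ι (e ≫ f)) ≫ p := hr
  refine IsSplitMono.mk' ⟨r, ?_⟩
  rw [← cancel_epi (pullback.snd e (kernel.ι f')), ← pullback.condition_assoc, hr,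
    key _ _ pullback.condition, Category.comp_id]

/-- A morphism into `N'` is annihilated by `m ≫ d` iff it is annihilated by the cokernel of the
pullback along `m` of the kernel `i` of `d`. -/
theorem comp_cokernel_pullback_snd_eq_zero_iff {A : Type u} [Category.{v} A] [Abelian A]
    {F N C N' Z : A} {i : F ⟶ N} {d : N ⟶ C} {w : i ≫ d = 0}
    (hse : (ShortComplex.mk i d w).ShortExact) (m : N' ⟶ N) (z : Z ⟶ N') :
    z ≫ m ≫ d = 0 ↔ z ≫ cokernel.π (pullback.snd i m) = 0 := by
  have : Mono i := hse.mono_f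
  constructor
  · intro h
    obtain ⟨t, ht⟩ := KernelFork.IsLimit.lift' hse.fIsKernel (z ≫ m) (by simpa using h)
    change t ≫ i = z ≫ m at ht
    rw [← pullback.lift_snd t z ht, Category.assoc, cokernel.condition, comp_zero]
  · intro h
    rw [← Abelian.monoLift_comp (pullback.snd i m) z h, Category.assoc,
      ← pullback.condition_assoc, w, comp_zero, comp_zero]

/-- Let `0 ⟶ F ⟶ N ⟶ C ⟶ 0` be a fully invariant short exact sequence,
`e : M ⟶ M'` an epimorphism and `m : N' ⟶ N` a monomorphism. If the pullback
projection `u : F ∩ N' ⟶ N'` is fully invariant and `N` is `M`-`F`-split,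
then `N'` is `M'`-`(F ∩ N')`-split: for every `g : M' ⟶ N'`, the kernel of
`d' ∘ g` is a split monomorphism, where `d'` is the cokernel of `u`. -/
theorem stmt_10 {A : Type u} [Category.{v} A] [Abelian A] {F N C M M' N' : A}
    (i : F ⟶ N) (d : N ⟶ C) (w : i ≫ d = 0)
    (hse : (ShortComplex.mk i d w).ShortExact) (hi : FullyInvariant i)
    (e : M ⟶ M') [Epi e] (m : N' ⟶ N) [Mono m]
    (hu : FullyInvariant (pullback.snd i m))
    (hMF : ∀ g : M ⟶ N, IsSplitMono (kernel.ι (g ≫ d))) :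
    ∀ g : M' ⟶ N', IsSplitMono (kernel.ι (g ≫ cokernel.π (pullback.snd i m))) := by
  intro g
  have : IsSplitMono (kernel.ι (e ≫ g ≫ m ≫ d)) := by
    have h : e ≫ g ≫ m ≫ d = (e ≫ g ≫ m) ≫ d := by simp
    rw [h]
    exact hMF _
  refine isSplitMono_kernel_of_epi_comp e (g ≫ m ≫ d) _ fun z ↦ ?_
  simpa using comp_cokernel_pullback_snd_eq_zero_iff hse m (z ≫ g)
end

section
/- Let A be an abelian category, let M and N be objects, and let 0 ⟶ F →i N →d C ⟶ 0 be a fully invariant short exact sequence. Then N is M-F-split if and only if for every split monomorphism s : M₁ ⟶ M (direct summand of M) and every split monomorphism t : N₁ ⟶ N (direct summand of N), the object N₁ is M₁-(F ∩ N₁)-split, where F ∩ N₁ is the pullback of i and t with projection u : F ∩ N₁ ⟶ N₁ (which is a fully invariant monomorphism), i.e., for every morphism g : M₁ ⟶ N₁ the kernel of d₁ ∘ g is a split monomorphism, where d₁ : N₁ ⟶ C₁ is the cokernel of u. -/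
open CategoryTheory CategoryTheory.Limits

universe v u

/-- A retract of a morphism with split kernel has split kernel: it suffices to relate the kernels
along a retract `s ≫ r = 𝟙 M₁` of the sources. -/
theorem isSplitMono_kernel_ι_of_retract {A : Type u} [Category.{v} A] [HasZeroMorphisms A]
    {M M₁ C C₁ : A} (f : M ⟶ C) (f₁ : M₁ ⟶ C₁) [HasKernel f] [HasKernel f₁]
    (s : M₁ ⟶ M) (r : M ⟶ M₁) (hsr : s ≫ r = 𝟙 M₁)
    (hs : (kernel.ι f₁ ≫ s) ≫ f = 0) (hr : (kernel.ι f ≫ r) ≫ f₁ = 0)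
    (hf : IsSplitMono (kernel.ι f)) : IsSplitMono (kernel.ι f₁) := by
  refine IsSplitMono.mk' ⟨s ≫ retraction (kernel.ι f) ≫ kernel.lift f₁ _ hr, ?_⟩
  have h : kernel.ι f₁ ≫ s = kernel.lift f _ hs ≫ kernel.ι f := by simp
  rw [reassoc_of% h, IsSplitMono.id_assoc, ← cancel_mono (kernel.ι f₁)]
  simp [hsr]

/-- The cokernel of `F ∩ N₁ ⟶ N₁` kills the same morphisms as `N₁ ⟶ N ⟶ C`. -/
theorem comp_cokernel_π_pullback_snd_eq_zero_iff {A : Type u} [Category.{v} A] [Abelian A]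
    {F N C N₁ X : A} {i : F ⟶ N} {d : N ⟶ C} {w : i ≫ d = 0}
    (hse : (ShortComplex.mk i d w).ShortExact) (t : N₁ ⟶ N) (x : X ⟶ N₁) :
    x ≫ cokernel.π (pullback.snd i t) = 0 ↔ x ≫ t ≫ d = 0 := by
  have : Mono i := hse.mono_f
  constructor
  · intro h
    have hu : pullback.snd i t ≫ t ≫ d = 0 := by
      rw [← pullback.condition_assoc, w, comp_zero]
    rw [← cokernel.π_desc (pullback.snd i t) (t ≫ d) hu, reassoc_of% h, zero_comp]
  · intro h
    have h' : (x ≫ t) ≫ d = 0 := by rw [Category.assoc, h]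
    have hx : hse.exact.lift (x ≫ t) h' ≫ i = x ≫ t := hse.exact.lift_f (x ≫ t) h'
    rw [← pullback.lift_snd _ _ hx, Category.assoc, cokernel.condition, comp_zero]

/-- Let `0 ⟶ F ⟶ N ⟶ C ⟶ 0` be a fully invariant short exact sequence and let
`M` be an object. Then `N` is `M`-`F`-split iff for every direct summand
`s : M₁ ⟶ M` and every direct summand `t : N₁ ⟶ N`, the object `N₁` is
`M₁`-`(F ∩ N₁)`-split: for every `g : M₁ ⟶ N₁`, the kernel of `d₁ ∘ g` is a
split monomorphism, where `d₁` is the cokernel of the pullback projection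
`u : F ∩ N₁ ⟶ N₁`. -/
theorem stmt_11 {A : Type u} [Category.{v} A] [Abelian A] {F N C : A} (M : A)
    (i : F ⟶ N) (d : N ⟶ C) (w : i ≫ d = 0)
    (hse : (ShortComplex.mk i d w).ShortExact) (hi : FullyInvariant i) :
    (∀ g : M ⟶ N, IsSplitMono (kernel.ι (g ≫ d))) ↔
      ∀ (M₁ N₁ : A) (s : M₁ ⟶ M) (t : N₁ ⟶ N), IsSplitMono s → IsSplitMono t →
        ∀ g : M₁ ⟶ N₁,
          IsSplitMono (kernel.ι (g ≫ cokernel.π (pullback.snd i t))) := by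
  constructor
  · intro H M₁ N₁ s t hs ht g
    refine isSplitMono_kernel_ι_of_retract ((retraction s ≫ g ≫ t) ≫ d) _ s (retraction s)
      (IsSplitMono.id s) ?_ ?_ (H _)
    · have h := (comp_cokernel_π_pullback_snd_eq_zero_iff hse t _).1
        ((Category.assoc _ _ _).trans (kernel.condition (g ≫ cokernel.π (pullback.snd i t))))
      simpa using h
    · refine (Category.assoc _ _ _).symm.trans
        ((comp_cokernel_π_pullback_snd_eq_zero_iff hse t _).2 ?_)
      simpa using kernel.condition ((retraction s ≫ g ≫ t) ≫ d)
  · intro H g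
    refine isSplitMono_kernel_ι_of_retract _ _ (𝟙 M) (𝟙 M) (Category.comp_id _) ?_ ?_
      (H M N (𝟙 M) (𝟙 N) inferInstance inferInstance g)
    · rw [Category.comp_id, ← Category.assoc, comp_cokernel_π_pullback_snd_eq_zero_iff hse]
      simp
    · have h := (comp_cokernel_π_pullback_snd_eq_zero_iff hse (𝟙 N) _).1
        ((Category.assoc _ _ _).trans
          (kernel.condition (g ≫ cokernel.π (pullback.snd i (𝟙 N)))))
      simpa using h
end

section
/- Let A be an abelian category and let 0 ⟶ F →i M →d C ⟶ 0 be a fully invariant short exact sequence in A. Then M is self-F-split if and only if i is a split monomorphism (so M ≅ F ⊕ C) and C is self-Rickart. -/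
open CategoryTheory CategoryTheory.Limits

universe v u

/-- The kernel of `f : X ⟶ Y` is a split monomorphism iff some endomorphism of `X` killed by `f`
fixes every morphism killed by `f`. -/
theorem isSplitMono_kernel_ι_iff {A : Type u} [Category.{v} A] [Abelian A] {X Y : A}
    (f : X ⟶ Y) :
    IsSplitMono (kernel.ι f) ↔
      ∃ p : X ⟶ X, p ≫ f = 0 ∧ ∀ {T : A} (t : T ⟶ X), t ≫ f = 0 → t ≫ p = t := by
  constructor
  · intro _
    refine ⟨retraction (kernel.ι f) ≫ kernel.ι f, by simp, fun t ht => ?_⟩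
    rw [← kernel.lift_ι f t ht]
    simp only [Category.assoc, IsSplitMono.id_assoc]
  · rintro ⟨p, hp, hfix⟩
    refine IsSplitMono.mk' ⟨kernel.lift f p hp, ?_⟩
    rw [← cancel_mono (kernel.ι f), Category.assoc, kernel.lift_ι, Category.id_comp]
    exact hfix _ (kernel.condition f)

/-- A split monomorphism in a short exact sequence gives a splitting of the sequence. -/
theorem CategoryTheory.ShortComplex.ShortExact.nonempty_splitting_of_isSplitMono
    {A : Type u} [Category.{v} A] [Abelian A] {S : ShortComplex A} (hS : S.ShortExact)
    [IsSplitMono S.f] : Nonempty S.Splitting :=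
  have := hS.epi_g
  ⟨.ofExactOfRetraction S hS.exact (retraction S.f) (IsSplitMono.id S.f) hS.epi_g⟩

/-- Let `0 ⟶ F ⟶ M ⟶ C ⟶ 0` be a fully invariant short exact sequence.
Then `M` is self-`F`-split iff `i` is a split monomorphism (so `M ≅ F ⊕ C`)
and `C` is self-Rickart. -/
theorem stmt_12 {A : Type u} [Category.{v} A] [Abelian A] {F M C : A}
    (i : F ⟶ M) (d : M ⟶ C) (w : i ≫ d = 0)
    (hse : (ShortComplex.mk i d w).ShortExact) (hi : FullyInvariant i) :
    (∀ g : M ⟶ M, IsSplitMono (kernel.ι (g ≫ d))) ↔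
      (IsSplitMono i ∧ ∀ f : C ⟶ C, IsSplitMono (kernel.ι f)) := by
  simp only [isSplitMono_kernel_ι_iff]
  constructor
  · intro H
    have hsplit : IsSplitMono i := by
      obtain ⟨p, hp, hfix⟩ := H (𝟙 M)
      rw [Category.id_comp] at hp
      have := hse.mono_f
      obtain ⟨r, hr⟩ : ∃ r : M ⟶ F, r ≫ i = p := ⟨hse.exact.lift p hp, hse.exact.lift_f p hp⟩
      refine IsSplitMono.mk' ⟨r, ?_⟩
      have : Mono i := hse.mono_f
      rw [← cancel_mono i, Category.assoc, hr, Category.id_comp]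
      exact hfix i (by rw [Category.id_comp, w])
    refine ⟨hsplit, fun f => ?_⟩
    have : IsSplitMono (ShortComplex.mk i d w).f := hsplit
    obtain ⟨⟨r, s, -, hs, -⟩⟩ := hse.nonempty_splitting_of_isSplitMono
    dsimp at r s hs
    obtain ⟨p, hp, hfix⟩ := H (d ≫ f ≫ s)
    simp only [Category.assoc, hs, Category.comp_id] at hp hfix
    refine ⟨s ≫ p ≫ d, by simp [hp], fun t ht => ?_⟩
    have hts := hfix (t ≫ s) (by simp [reassoc_of% hs, ht])
    simp only [Category.assoc] at hts
    rw [reassoc_of% hts, hs, Category.comp_id]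
  · rintro ⟨hsplit, H⟩ g
    have : IsSplitMono (ShortComplex.mk i d w).f := hsplit
    obtain ⟨⟨r, s, -, hs, hid⟩⟩ := hse.nonempty_splitting_of_isSplitMono
    dsimp at r s hs hid
    obtain ⟨α, hα⟩ := hi g
    obtain ⟨q, hq, hfix⟩ := H (s ≫ g ≫ d)
    have hgd : g ≫ d = d ≫ s ≫ g ≫ d := by
      calc g ≫ d = (r ≫ i + d ≫ s) ≫ g ≫ d := by rw [hid, Category.id_comp]
        _ = d ≫ s ≫ g ≫ d := by simp [reassoc_of% hα, w]
    rw [hgd]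
    refine ⟨r ≫ i + d ≫ q ≫ s, by simp [reassoc_of% w, reassoc_of% hs, hq], fun t ht => ?_⟩
    have htq := hfix (t ≫ d) (by simpa using ht)
    rw [Category.assoc] at htq
    rw [Preadditive.comp_add, reassoc_of% htq, ← Preadditive.comp_add, hid, Category.comp_id]
end

section
/- Let A be an abelian category and let 0 ⟶ F →i M →d C ⟶ 0 be a fully invariant short exact sequence in A. Then M is dual self-F-split if and only if i is a split monomorphism (so M ≅ F ⊕ C) and F is dual self-Rickart. -/
open CategoryTheory CategoryTheory.Limits

universe v u

theorem isSplitEpi_cokernel_π_iff {A : Type u} [Category.{v} A] [Abelian A] {X Y : A}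
    (f : X ⟶ Y) :
    IsSplitEpi (cokernel.π f) ↔
      ∃ e : Y ⟶ Y, f ≫ e = 0 ∧ e ≫ cokernel.π f = cokernel.π f := by
  constructor
  · intro _
    exact ⟨cokernel.π f ≫ section_ (cokernel.π f), by simp, by simp⟩
  · rintro ⟨e, he, hπ⟩
    refine IsSplitEpi.mk' ⟨cokernel.desc f e he, ?_⟩
    rw [← cancel_epi (cokernel.π f)]
    simp [hπ]

/-- Composing with a split monomorphism does not affect whether the cokernel projection splits. -/
theorem isSplitEpi_cokernel_π_comp_iff {A : Type u} [Category.{v} A] [Abelian A] {X F M : A}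
    (f : X ⟶ F) (i : F ⟶ M) [IsSplitMono i] :
    IsSplitEpi (cokernel.π (f ≫ i)) ↔ IsSplitEpi (cokernel.π f) := by
  rw [isSplitEpi_cokernel_π_iff, isSplitEpi_cokernel_π_iff]
  constructor
  · rintro ⟨e, he, hπ⟩
    refine ⟨i ≫ e ≫ retraction i, by rw [← Category.assoc i, ← Category.assoc f, ← Category.assoc f,
      he, zero_comp], ?_⟩
    have h : (f ≫ i) ≫ retraction i ≫ cokernel.π f = 0 := by simp
    have ht := cokernel.π_desc (f ≫ i) _ h
    rw [Category.assoc, Category.assoc, ← ht, reassoc_of% hπ, ht, IsSplitMono.id_assoc]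
  · rintro ⟨e, he, hπ⟩
    refine ⟨𝟙 M - retraction i ≫ i + retraction i ≫ e ≫ i, ?_, ?_⟩
    · simp [Preadditive.comp_add, Preadditive.comp_sub, reassoc_of% he]
    · have h : f ≫ i ≫ cokernel.π (f ≫ i) = 0 := by
        rw [← Category.assoc, cokernel.condition]
      have ht := cokernel.π_desc f _ h
      have hk : e ≫ i ≫ cokernel.π (f ≫ i) = i ≫ cokernel.π (f ≫ i) := by
        rw [← ht, reassoc_of% hπ]
      simp [Preadditive.add_comp, Preadditive.sub_comp, hk]

theorem isSplitMono_of_isSplitEpi_cokernel_π {A : Type u} [Category.{v} A] [Abelian A]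
    {F M : A} (i : F ⟶ M) [Mono i] (h : IsSplitEpi (cokernel.π i)) : IsSplitMono i := by
  obtain ⟨e, he, hπ⟩ := (isSplitEpi_cokernel_π_iff i).1 h
  have hk : (𝟙 M - e) ≫ cokernel.π i = 0 := by simp [Preadditive.sub_comp, hπ]
  refine IsSplitMono.mk' ⟨Abelian.monoLift i (𝟙 M - e) hk, ?_⟩
  rw [← cancel_mono i, Category.assoc, Abelian.monoLift_comp]
  simp [Preadditive.comp_sub, he]

/-- Let `0 ⟶ F ⟶ M ⟶ C ⟶ 0` be a fully invariant short exact sequence.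
Then `M` is dual self-`F`-split (for every `g : M ⟶ M` the cokernel of
`g ∘ i` is a split epimorphism) iff `i` is a split monomorphism
(so `M ≅ F ⊕ C`) and `F` is dual self-Rickart. -/
theorem stmt_13 {A : Type u} [Category.{v} A] [Abelian A] {F M C : A}
    (i : F ⟶ M) (d : M ⟶ C) (w : i ≫ d = 0)
    (hse : (ShortComplex.mk i d w).ShortExact) (hi : FullyInvariant i) :
    (∀ g : M ⟶ M, IsSplitEpi (cokernel.π (i ≫ g))) ↔
      (IsSplitMono i ∧ ∀ f : F ⟶ F, IsSplitEpi (cokernel.π f)) := by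
  have : Mono i := hse.mono_f
  constructor
  · intro h
    have hi₁ : IsSplitMono i := isSplitMono_of_isSplitEpi_cokernel_π i (by
      have h₁ := h (𝟙 M)
      rwa [Category.comp_id] at h₁)
    refine ⟨hi₁, fun f => (isSplitEpi_cokernel_π_comp_iff f i).1 ?_⟩
    have hf := h (retraction i ≫ f ≫ i)
    rwa [IsSplitMono.id_assoc] at hf
  · rintro ⟨_, h⟩ g
    obtain ⟨α, hα⟩ := hi g
    rw [hα]
    exact (isSplitEpi_cokernel_π_comp_iff α i).2 (h α)
end

section
/- Let A be an abelian category and let 0 ⟶ F →i M →d C ⟶ 0 be a fully invariant short exact sequence in A. Then M is strongly self-F-split if and only if M is self-F-split and the endomorphism ring End(C) is abelian, i.e., every idempotent endomorphism of C is central in End(C). -/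
open CategoryTheory CategoryTheory.Limits

universe v u

/-- A kernel inclusion `kernel.ι f` is fully invariant iff every endomorphism of the source maps
the kernel into the kernel. -/
lemma fullyInvariant_kernel_iff {A : Type u} [Category.{v} A] [Abelian A] {M C : A} (f : M ⟶ C) :
    FullyInvariant (kernel.ι f) ↔ ∀ h : M ⟶ M, kernel.ι f ≫ h ≫ f = 0 := by
  refine ⟨fun hf h ↦ ?_, fun hf h ↦ ⟨kernel.lift f (kernel.ι f ≫ h) (by simpa using hf h), by simp⟩⟩
  obtain ⟨α, hα⟩ := hf h
  rw [reassoc_of% hα, kernel.condition, comp_zero]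

/-- In an exact sequence `F ⟶ M ⟶ C` with `M ⟶ C` epi, a morphism vanishing on `F` factors
through `C`. -/
lemma exists_comp_eq_of_shortExact {A : Type u} [Category.{v} A] [Abelian A] {F M C X : A}
    {i : F ⟶ M} {d : M ⟶ C} {w : i ≫ d = 0} (hse : (ShortComplex.mk i d w).ShortExact)
    (f : M ⟶ X) (hf : i ≫ f = 0) : ∃ f' : C ⟶ X, d ≫ f' = f :=
  haveI := hse.epi_g
  ⟨hse.exact.desc f hf, hse.exact.g_desc f hf⟩

/-- An epimorphism whose kernel is a split monomorphism has a section. -/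
lemma exists_section_of_isSplitMono_kernel {A : Type u} [Category.{v} A] [Abelian A] {M C : A}
    (d : M ⟶ C) [Epi d] [IsSplitMono (kernel.ι d)] : ∃ s : C ⟶ M, s ≫ d = 𝟙 C := by
  let ρ := retraction (kernel.ι d)
  have hρ : kernel.ι d ≫ (𝟙 M - ρ ≫ kernel.ι d) = 0 := by
    simp [ρ, Preadditive.comp_sub]
  refine ⟨Abelian.epiDesc d (𝟙 M - ρ ≫ kernel.ι d) hρ, ?_⟩
  rw [← cancel_epi d, ← Category.assoc, Abelian.comp_epiDesc]
  simp [Preadditive.sub_comp]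

/-- If `d` has a section and the kernel of `d ≫ e` is fully invariant for an idempotent `e`,
then every endomorphism preserves the kernel of `e`. -/
lemma comp_idempotent_eq_of_fullyInvariant {A : Type u} [Category.{v} A] [Abelian A] {M C : A}
    {d : M ⟶ C} {s : C ⟶ M} (hs : s ≫ d = 𝟙 C) {e : C ⟶ C} (he : e ≫ e = e)
    (hinv : FullyInvariant (kernel.ι (d ≫ e))) (f : C ⟶ C) : f ≫ e = e ≫ f ≫ e := by
  have hk := (fullyInvariant_kernel_iff _).1 hinv (d ≫ f ≫ s)
  simp only [Category.assoc, reassoc_of% hs] at hk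
  have hl : ((𝟙 C - e) ≫ s) ≫ d ≫ e = 0 := by
    simp [reassoc_of% hs, Preadditive.sub_comp, he]
  have h := kernel.lift (d ≫ e) _ hl ≫= hk
  simpa [reassoc_of% hs, Preadditive.sub_comp, sub_eq_zero] using h

/-- Let `0 ⟶ F ⟶ M ⟶ C ⟶ 0` be a fully invariant short exact sequence.
Then `M` is strongly self-`F`-split iff `M` is self-`F`-split and the
endomorphism ring of `C` is abelian, i.e. every idempotent endomorphism of `C`
commutes with every endomorphism of `C`. -/
theorem stmt_14 {A : Type u} [Category.{v} A] [Abelian A] {F M C : A}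
    (i : F ⟶ M) (d : M ⟶ C) (w : i ≫ d = 0)
    (hse : (ShortComplex.mk i d w).ShortExact) (hi : FullyInvariant i) :
    (∀ g : M ⟶ M, IsSplitMono (kernel.ι (g ≫ d)) ∧ FullyInvariant (kernel.ι (g ≫ d))) ↔
      ((∀ g : M ⟶ M, IsSplitMono (kernel.ι (g ≫ d))) ∧
        ∀ e : C ⟶ C, e ≫ e = e → ∀ f : C ⟶ C, e ≫ f = f ≫ e) := by
  have : Epi d := hse.epi_g
  constructor
  · intro H
    refine ⟨fun g ↦ (H g).1, fun e he f ↦ ?_⟩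
    have : IsSplitMono (kernel.ι d) := Category.id_comp d ▸ (H (𝟙 M)).1
    obtain ⟨s, hs⟩ := exists_section_of_isSplitMono_kernel d
    have key (a : C ⟶ C) (ha : a ≫ a = a) : f ≫ a = a ≫ f ≫ a := by
      refine comp_idempotent_eq_of_fullyInvariant hs ha ?_ f
      have hg : (d ≫ a ≫ s) ≫ d = d ≫ a := by simp [hs]
      exact hg ▸ (H (d ≫ a ≫ s)).2
    have h := key (𝟙 C - e) (by simp [Preadditive.sub_comp, Preadditive.comp_sub, he])
    symm
    simpa [Preadditive.sub_comp, Preadditive.comp_sub, ← key e he, sub_eq_zero] using h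
  · rintro ⟨H, hC⟩
    refine fun g ↦ ⟨H g, (fullyInvariant_kernel_iff _).2 fun h ↦ ?_⟩
    have := H g
    have induced (x : M ⟶ M) : ∃ x' : C ⟶ C, d ≫ x' = x ≫ d := by
      obtain ⟨α, hα⟩ := hi x
      exact exists_comp_eq_of_shortExact hse _ (by rw [reassoc_of% hα, w, comp_zero])
    let k := kernel.ι (g ≫ d)
    let p := retraction k ≫ k
    have hkp : k ≫ p = k := by simp [p]
    have hpg : p ≫ g ≫ d = 0 := by simp [p, k]
    obtain ⟨g', hg⟩ := induced g
    obtain ⟨h', hh⟩ := induced h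
    obtain ⟨p', hp⟩ := induced p
    have hp' : p' ≫ p' = p' := by
      rw [← cancel_epi d, reassoc_of% hp, hp]
      simp [p]
    have hpg' : p' ≫ g' = 0 := by
      rw [← cancel_epi d, reassoc_of% hp, hg, hpg, comp_zero]
    calc k ≫ h ≫ g ≫ d = k ≫ p ≫ h ≫ g ≫ d := by rw [reassoc_of% hkp]
      _ = k ≫ d ≫ p' ≫ h' ≫ g' := by
        rw [reassoc_of% hp, reassoc_of% hh, hg]
      _ = 0 := by rw [reassoc_of% hC p' hp' h', hpg', comp_zero, comp_zero, comp_zero]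
end

section
/- Let R be a ring with identity. Then R is semisimple if and only if for every right R-module N, every fully invariant submodule F of N, and every R-linear endomorphism g of N, the preimage g⁻¹(F) is a direct summand of N. -/
universe u

/-- A submodule `I` of `M` is a direct summand as soon as `I × M ⧸ I`, the kernel of the
endomorphism `(a, b) ↦ (0, a mod I)` of `M × M ⧸ I`, is a direct summand. -/
theorem Submodule.exists_isCompl_of_exists_isCompl_ker {S M : Type*} [Ring S] [AddCommGroup M]
    [Module S M] (I : Submodule S M)
    (h : ∃ Q : Submodule S (M × M ⧸ I), IsCompl
      (LinearMap.ker (LinearMap.inr S M (M ⧸ I) ∘ₗ I.mkQ ∘ₗ LinearMap.fst S M (M ⧸ I))) Q) :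
    ∃ J : Submodule S M, IsCompl I J := by
  obtain ⟨Q, hQ⟩ := h
  have mem_ker (x : M × M ⧸ I) : x ∈ LinearMap.ker
      (LinearMap.inr S M (M ⧸ I) ∘ₗ I.mkQ ∘ₗ LinearMap.fst S M (M ⧸ I)) ↔ x.1 ∈ I := by
    simp
  let r : M →ₗ[S] I := LinearMap.codRestrict I
    (LinearMap.fst S M (M ⧸ I) ∘ₗ Submodule.subtype _ ∘ₗ
      Submodule.projectionOnto _ Q hQ ∘ₗ LinearMap.inl S M (M ⧸ I))
    fun c ↦ (mem_ker _).1 (Submodule.projectionOnto _ Q hQ (c, 0)).2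
  refine ⟨LinearMap.ker r, LinearMap.isCompl_of_proj fun x ↦ Subtype.ext ?_⟩
  exact congrArg (fun y ↦ y.1.1) (Submodule.projectionOnto_apply_left hQ
    ⟨((x : M), 0), (mem_ker _).2 x.2⟩)

/-- A ring `R` is semisimple iff for every right `R`-module `N` (modeled as a
module over `Rᵐᵒᵖ`), every fully invariant submodule `F` of `N`, and every
endomorphism `g` of `N`, the preimage `g⁻¹(F)` is a direct summand of `N`. -/
theorem stmt_18 {R : Type u} [Ring R] :
    IsSemisimpleRing R ↔
      ∀ (N : Type u) [AddCommGroup N] [Module Rᵐᵒᵖ N] (F : Submodule Rᵐᵒᵖ N),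
        (∀ f : N →ₗ[Rᵐᵒᵖ] N, F.map f ≤ F) →
          ∀ g : N →ₗ[Rᵐᵒᵖ] N, ∃ Q : Submodule Rᵐᵒᵖ N, IsCompl (F.comap g) Q := by
  rw [← isSemisimpleRing_mulOpposite_iff]
  constructor
  · intro _ N _ _ F _ g
    exact exists_isCompl _
  · intro h
    refine (isSemisimpleModule_iff _ _).2 ⟨fun I ↦ ?_⟩
    exact I.exists_isCompl_of_exists_isCompl_ker
      (h (Rᵐᵒᵖ × Rᵐᵒᵖ ⧸ I) ⊥ (fun f ↦ by simp) _)
end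

section
/- Let R be a ring with identity. Then R is von Neumann regular (for every a ∈ R there exists b ∈ R with a b a = a) if and only if for every finitely generated projective right R-module N, every finitely generated fully invariant submodule F of N, and every R-linear endomorphism g of N, the image g(F) is a direct summand of N. -/
universe u

/-- Over a von Neumann regular ring, finitely many values `f x` of linear functionals at a fixed
vector `x` admit a common left unit which is itself such a value. -/
theorem exists_dual_apply_mul_eq {S M : Type*} [Ring S] [AddCommGroup M] [Module S M]
    (hS : ∀ a : S, ∃ b : S, a * b * a = a) (x : M) {ι : Type*} (f : ι → M →ₗ[S] S)
    (s : Finset ι) : ∃ φ : M →ₗ[S] S, ∀ i ∈ s, φ x * f i x = f i x := by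
  classical
  induction s using Finset.induction_on with
  | empty => exact ⟨0, by simp⟩
  | insert j s _ ih =>
    obtain ⟨φ, hφ⟩ := ih
    obtain ⟨b, hb⟩ := hS (f j x - φ x * f j x)
    let ρ (c : S) : S →ₗ[S] S := LinearMap.toSpanSingleton S S c
    refine ⟨φ + ρ (b * (1 - φ x)) ∘ₗ (f j - ρ (f j x) ∘ₗ φ), fun i hi => ?_⟩
    have key : (φ + ρ (b * (1 - φ x)) ∘ₗ (f j - ρ (f j x) ∘ₗ φ)) x
        = φ x + (f j x - φ x * f j x) * (b * (1 - φ x)) := by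
      simp [ρ]
    rw [key]
    rcases Finset.mem_insert.1 hi with rfl | hi
    · calc (φ x + (f i x - φ x * f i x) * (b * (1 - φ x))) * f i x
          = φ x * f i x + (f i x - φ x * f i x) * b * (f i x - φ x * f i x) := by noncomm_ring
        _ = f i x := by rw [hb]; abel
    · have h0 : (1 - φ x) * f i x = 0 := by rw [sub_mul, one_mul, hφ i hi, sub_self]
      rw [add_mul, mul_assoc, mul_assoc, h0, mul_zero, mul_zero, add_zero, hφ i hi]

/-- Projective modules over a von Neumann regular ring are regular in the sense of Zelmanowitz. -/
theorem exists_dual_apply_smul_eq {S M : Type*} [Ring S] [AddCommGroup M] [Module S M]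
    [Module.Projective S M] (hS : ∀ a : S, ∃ b : S, a * b * a = a) (x : M) :
    ∃ φ : M →ₗ[S] S, φ x • x = x := by
  obtain ⟨s, hs⟩ := Module.projective_def.1 ‹Module.Projective S M›
  obtain ⟨φ, hφ⟩ := exists_dual_apply_mul_eq hS x (fun m : M => Finsupp.lapply m ∘ₗ s)
    (s x).support
  refine ⟨φ, ?_⟩
  have hx : ∑ m ∈ (s x).support, s x m • m = x := hs x
  calc φ x • x = φ x • ∑ m ∈ (s x).support, s x m • m := by rw [hx]
    _ = ∑ m ∈ (s x).support, s x m • m := by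
      rw [Finset.smul_sum]
      refine Finset.sum_congr rfl fun m hm => ?_
      rw [smul_smul]
      exact congrArg (· • m) (hφ m hm)
    _ = x := hx

/-- A finitely generated submodule of a projective module over a von Neumann regular ring is the
image of a linear projection. -/
theorem Submodule.FG.exists_isProj {S M : Type*} [Ring S] [AddCommGroup M] [Module S M]
    [Module.Projective S M] (hS : ∀ a : S, ∃ b : S, a * b * a = a) {K : Submodule S M}
    (hK : K.FG) : ∃ p : M →ₗ[S] M, LinearMap.IsProj K p := by
  classical
  obtain ⟨t, rfl⟩ := hK
  induction t using Finset.induction_on with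
  | empty => exact ⟨0, by simp, by simp⟩
  | insert x t _ ih =>
    obtain ⟨e, he⟩ := ih
    obtain ⟨φ, hφ⟩ := exists_dual_apply_smul_eq hS (x - e x)
    set K := Submodule.span S (t : Set M)
    have hle : K ≤ Submodule.span S (insert x t : Finset M) :=
      Submodule.span_mono (by simp)
    have hx : x ∈ Submodule.span S ((insert x t : Finset M) : Set M) :=
      Submodule.subset_span (by simp)
    let p : M →ₗ[S] M :=
      e + LinearMap.toSpanSingleton S M (x - e x) ∘ₗ φ ∘ₗ (LinearMap.id - e)
    have hp (m : M) : p m = e m + φ (m - e m) • (x - e x) := rfl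
    refine ⟨p, fun m => ?_, fun m hm => ?_⟩
    · rw [hp]
      exact add_mem (hle (he.map_mem m))
        (Submodule.smul_mem _ _ (sub_mem hx (hle (he.map_mem x))))
    · have hfix : Submodule.span S ((insert x t : Finset M) : Set M)
          ≤ LinearMap.eqLocus p LinearMap.id := by
        rw [Submodule.span_le]
        intro y hy
        change p y = y
        rcases Finset.mem_insert.1 (Finset.mem_coe.1 hy) with rfl | hy
        · rw [hp, hφ, add_sub_cancel]
        · rw [hp, he.map_id y (Submodule.subset_span hy), sub_self, map_zero, zero_smul, add_zero]
      exact hfix hm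

/-- If every principal left ideal of a ring is a direct summand, the ring is von Neumann
regular. -/
theorem exists_mul_mul_eq_of_isCompl_range {S : Type*} [Ring S] {a : S} {Q : Submodule S S}
    (h : IsCompl (LinearMap.range (LinearMap.toSpanSingleton S S a)) Q) :
    ∃ b : S, a * b * a = a := by
  obtain ⟨_, ⟨b, rfl⟩, q, hq, hbq⟩ :=
    Submodule.mem_sup.1 (h.sup_eq_top ▸ Submodule.mem_top : (1 : S) ∈ _ ⊔ Q)
  have hbq' : b * a + q = 1 := hbq
  have haq : a * q = a - a * b * a := by
    rw [eq_sub_iff_add_eq', mul_assoc, ← mul_add, hbq', mul_one]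
  have hmem : a * q ∈ LinearMap.range (LinearMap.toSpanSingleton S S a) :=
    ⟨1 - a * b, by simp [haq, sub_mul]⟩
  have h0 : a * q = 0 :=
    (Submodule.disjoint_def.1 h.disjoint) _ hmem (Q.smul_mem a hq)
  exact ⟨b, (sub_eq_zero.1 (haq ▸ h0)).symm⟩

/-- A ring `R` is von Neumann regular iff for every finitely generated
projective right `R`-module `N` (modeled as a module over `Rᵐᵒᵖ`), every
finitely generated fully invariant submodule `F` of `N`, and every
endomorphism `g` of `N`, the image `g(F)` is a direct summand of `N`. -/
theorem stmt_19 {R : Type u} [Ring R] :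
    (∀ a : R, ∃ b : R, a * b * a = a) ↔
      ∀ (N : Type u) [AddCommGroup N] [Module Rᵐᵒᵖ N],
        Module.Finite Rᵐᵒᵖ N → Module.Projective Rᵐᵒᵖ N →
          ∀ F : Submodule Rᵐᵒᵖ N, F.FG →
            (∀ f : N →ₗ[Rᵐᵒᵖ] N, F.map f ≤ F) →
              ∀ g : N →ₗ[Rᵐᵒᵖ] N, ∃ Q : Submodule Rᵐᵒᵖ N, IsCompl (F.map g) Q := by
  constructor
  · intro hR N _ _ _ _ F hF _ g
    have hS (a : Rᵐᵒᵖ) : ∃ b : Rᵐᵒᵖ, a * b * a = a := by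
      obtain ⟨b, hb⟩ := hR a.unop
      exact ⟨MulOpposite.op b, MulOpposite.unop_injective (by simpa [mul_assoc] using hb)⟩
    obtain ⟨p, hp⟩ := (hF.map g).exists_isProj hS
    exact ⟨LinearMap.ker p, hp.isCompl⟩
  · intro h a
    obtain ⟨Q, hQ⟩ := h Rᵐᵒᵖ inferInstance inferInstance ⊤ Module.Finite.fg_top
      (fun _ => le_top) (LinearMap.toSpanSingleton Rᵐᵒᵖ Rᵐᵒᵖ (MulOpposite.op a))
    rw [Submodule.map_top] at hQ
    obtain ⟨b, hb⟩ := exists_mul_mul_eq_of_isCompl_range hQ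
    exact ⟨b.unop, by simpa [mul_assoc] using congrArg MulOpposite.unop hb⟩
end
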